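/- Let b ∈ ℤ with b ≤ −4 and write B = |b|. Then for every integer k ≥ 1, both (ℤ, b, {0, 1, …, B − 2} ∪ {B − 1 − b^k}) and (ℤ, b, ({1, 2, …, B} \ {3}) ∪ {3 − b^k}) are number systems. In particular, for each base b ≤ −4 there exist infinitely many valid digit sets containing 0 and infinitely many valid digit sets not containing 0. -/

import Mathlib

def IsExpansion (b : ℤ) (D : Finset ℤ) (a : ℤ) (ℓ : ℕ) (f : ℕ → ℤ) : Prop :=
  1 ≤ ℓ ∧ (∀ i < ℓ, f i ∈ D) ∧ a = ∑ i ∈ Finset.range ℓ, f i * b ^ i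

def IsNumberSystem (b : ℤ) (D : Finset ℤ) : Prop :=
  ∀ a : ℤ, ∃ ℓ : ℕ, ∃ f : ℕ → ℤ, IsExpansion b D a ℓ f

lemma IsExpansion.cons {b : ℤ} {D : Finset ℤ} {a d : ℤ} {ℓ : ℕ} {f : ℕ → ℤ}
    (h : IsExpansion b D a ℓ f) (hd : d ∈ D) :
    IsExpansion b D (d + b * a) (ℓ + 1) (fun i => Nat.casesOn i d f) := by
  obtain ⟨_, hf, rfl⟩ := h
  refine ⟨by omega, ?_, ?_⟩
  · rintro (_ | i) hi
    · exact hd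
    · exact hf i (by omega)
  · rw [Finset.sum_range_succ', Finset.mul_sum, add_comm]
    simp only [pow_zero, mul_one]
    exact congrArg (· + d) (Finset.sum_congr rfl fun i _ => by ring)

lemma isExpansion_single {b d : ℤ} {D : Finset ℤ} (hd : d ∈ D) :
    IsExpansion b D d 1 (fun _ => d) :=
  ⟨le_rfl, fun _ _ => hd, by simp⟩

def Representable (b : ℤ) (D : Finset ℤ) (a : ℤ) : Prop :=
  ∃ ℓ : ℕ, ∃ f : ℕ → ℤ, IsExpansion b D a ℓ f

lemma Representable.cons {b : ℤ} {D : Finset ℤ} {a d v : ℤ} (h : Representable b D a)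
    (hd : d ∈ D) (hv : v = d + b * a) : Representable b D v := by
  obtain ⟨ℓ, f, h⟩ := h
  exact hv ▸ ⟨_, _, h.cons hd⟩

lemma ofDigits_cons_int (b : ℤ) (x : ℕ) (l : List ℕ) :
    Nat.ofDigits b (x :: l) = x + b * Nat.ofDigits b l := rfl

lemma ofDigits_concat_int (b : ℤ) (l : List ℕ) (x : ℕ) :
    Nat.ofDigits b (l ++ [x]) = Nat.ofDigits b l + b ^ l.length * x := by
  induction l with
  | nil => simp [Nat.ofDigits]
  | cons y t ih =>
    rw [List.cons_append, ofDigits_cons_int, ih, ofDigits_cons_int, List.length_cons]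
    ring

/-- Numbers with binary digits in base `b`, and their successors, are representable. -/
lemma representable_ofDigits {b : ℤ} {D : Finset ℤ} (h₀ : 0 ∈ D ∨ -b ∈ D) (h₁ : 1 ∈ D)
    (h₂ : 2 ∈ D) (l : List ℕ) (hl : ∀ x ∈ l, x ≤ 1) :
    Representable b D (Nat.ofDigits b l) ∧ Representable b D (1 + Nat.ofDigits b l) := by
  induction l with
  | nil =>
    have one : Representable b D 1 := ⟨_, _, isExpansion_single h₁⟩
    change Representable b D 0 ∧ Representable b D (1 + 0)
    refine ⟨?_, one⟩
    rcases h₀ with h₀ | h₀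
    · exact ⟨_, _, isExpansion_single h₀⟩
    · exact one.cons h₀ (by ring)
  | cons x t ih =>
    obtain ⟨ih₀, ih₁⟩ := ih fun y hy => hl y (List.mem_cons_of_mem _ hy)
    have hx : x ≤ 1 := hl x List.mem_cons_self
    rw [ofDigits_cons_int]
    interval_cases x
    · refine ⟨?_, ih₀.cons h₁ (by push_cast; ring)⟩
      rcases h₀ with h₀ | h₀
      · exact ih₀.cons h₀ (by push_cast; ring)
      · exact ih₁.cons h₀ (by push_cast; ring)
    · exact ⟨ih₀.cons h₁ (by push_cast; ring), ih₀.cons h₂ (by push_cast; ring)⟩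

lemma natAbs_lt_or_of_mul_eq {b m x d q : ℤ} (hb : b ≤ -4) (hx₀ : 0 ≤ x) (hx₁ : x ≤ 1)
    (hd₀ : 0 ≤ d) (hd₁ : d ≤ -b) (h : m + x - d = b * q) (hm₀ : m ≠ 0) (hm₁ : m ≠ 1) :
    q.natAbs < m.natAbs ∨ q = 0 ∨ q = 1 := by
  by_cases hm : m = -1
  · right
    have : 0 ≤ q := by by_contra! hq; nlinarith
    have : q < 2 := by by_contra! hq; nlinarith
    omega
  left
  zify
  have hm2 : 2 ≤ |m| := by
    rcases abs_cases m with h | h <;> omega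
  have hq : -b * |q| ≤ |m| + 1 - b := by
    have : -b * |q| = |m + x - d| := by
      rw [h, abs_mul, abs_of_neg (by omega : b < 0)]
    rw [this, abs_le]
    constructor <;> linarith [neg_abs_le m, le_abs_self m]
  by_contra! hlt
  nlinarith

/-- If a residue system in `[0, |b|]` has some of its digits `d` replaced by `d - b ^ k`, the
result is still a digit set of a number system provided small numbers keep their digits. -/
lemma isNumberSystem_of_shifted_digits {b : ℤ} {D : Finset ℤ} {k : ℕ} (hb : b ≤ -4) (hk : 1 ≤ k)
    (h₀ : 0 ∈ D ∨ -b ∈ D) (h₁ : 1 ∈ D) (h₂ : 2 ∈ D)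
    (hD : ∀ v : ℤ, ∃ d, 0 ≤ d ∧ d ≤ -b ∧ b ∣ v - d ∧ (d ∈ D ∨ d - b ^ k ∈ D)) :
    IsNumberSystem b D := by
  have small := representable_ofDigits h₀ h₁ h₂
  suffices key : ∀ n : ℕ, ∀ m : ℤ, m.natAbs = n → ∀ l : List ℕ, l.length = k →
      (∀ x ∈ l, x ≤ 1) → Representable b D (m + Nat.ofDigits b l) by
    intro a
    have h := key _ (a - Nat.ofDigits b (List.replicate k 0)) rfl (List.replicate k 0) (by simp)
      fun x hx => by simp [List.eq_of_mem_replicate hx]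
    rwa [sub_add_cancel] at h
  intro n
  induction n using Nat.strong_induction_on with
  | _ n ih =>
    rintro m rfl l hlen hl
    by_cases hm₀ : m = 0
    · simpa [hm₀] using (small l hl).1
    by_cases hm₁ : m = 1
    · simpa [hm₁] using (small l hl).2
    match l with
    | [] => simp at hlen; omega
    | x :: t =>
      have hx : x ≤ 1 := hl x List.mem_cons_self
      have ht : ∀ y ∈ t, y ≤ 1 := fun y hy => hl y (List.mem_cons_of_mem _ hy)
      obtain ⟨d, hd₀, hd₁, ⟨q, hq⟩, hd⟩ := hD (m + x)
      have next : ∀ y : ℕ, y ≤ 1 → Representable b D (q + Nat.ofDigits b (t ++ [y])) := by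
        intro y hy
        have hty : ∀ z ∈ t ++ [y], z ≤ 1 := by
          intro z hz
          rcases List.mem_append.1 hz with hz | hz
          · exact ht z hz
          · simp_all
        rcases natAbs_lt_or_of_mul_eq hb (by positivity) (by exact_mod_cast hx) hd₀ hd₁ hq hm₀ hm₁
          with hlt | rfl | rfl
        · exact ih _ hlt q rfl _ (by simpa using hlen) hty
        · simpa using (small _ hty).1
        · exact (small _ hty).2
      have hpow : b ^ k = b * b ^ t.length := by
        rw [← hlen, List.length_cons, pow_succ']
      rw [ofDigits_cons_int]
      rcases hd with hd | hd
      · refine (next 0 (by omega)).cons hd ?_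
        rw [ofDigits_concat_int]
        push_cast
        linear_combination hq
      · refine (next 1 le_rfl).cons hd ?_
        rw [ofDigits_concat_int]
        push_cast
        linear_combination hq + hpow

lemma isNumberSystem_with_zero {b : ℤ} (hb : b ≤ -4) {k : ℕ} (hk : 1 ≤ k) :
    IsNumberSystem b (insert (|b| - 1 - b ^ k) (Finset.Icc 0 (|b| - 2))) := by
  have habs : |b| = -b := abs_of_neg (by omega)
  refine isNumberSystem_of_shifted_digits hb hk (.inl ?_) ?_ ?_ fun v => ?_
  iterate 3 exact Finset.mem_insert_of_mem (Finset.mem_Icc.2 (by omega))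
  have hlt := Int.emod_lt_abs v (by omega : b ≠ 0)
  have hnn := Int.emod_nonneg v (by omega : b ≠ 0)
  refine ⟨v % b, hnn, by omega, Int.dvd_self_sub_emod, ?_⟩
  simp only [Finset.mem_insert, Finset.mem_Icc]
  by_cases h : v % b = |b| - 1
  · exact .inr (.inl (by rw [h]))
  · exact .inl (.inr (by omega))

lemma isNumberSystem_without_zero {b : ℤ} (hb : b ≤ -4) {k : ℕ} (hk : 1 ≤ k) :
    IsNumberSystem b (insert (3 - b ^ k) ((Finset.Icc 1 |b|).erase 3)) := by
  have habs : |b| = -b := abs_of_neg (by omega)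
  refine isNumberSystem_of_shifted_digits hb hk (.inr ?_) ?_ ?_ fun v => ?_
  iterate 3
    exact Finset.mem_insert_of_mem (Finset.mem_erase.2 ⟨by omega, Finset.mem_Icc.2 (by omega)⟩)
  have hlt := Int.emod_lt_abs (v - 1) (by omega : b ≠ 0)
  have hnn := Int.emod_nonneg (v - 1) (by omega : b ≠ 0)
  refine ⟨(v - 1) % b + 1, by omega, by omega, ?_, ?_⟩
  · have h : b ∣ v - 1 - (v - 1) % b := Int.dvd_self_sub_emod
    convert h using 1
    ring
  simp only [Finset.mem_insert, Finset.mem_erase, Finset.mem_Icc]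
  by_cases h : (v - 1) % b + 1 = 3
  · exact .inr (.inl (by rw [h]))
  · exact .inl (.inr (by omega))

lemma injective_insert_sub_pow {b c : ℤ} {S : Finset ℤ} (hb : b ≤ -4)
    (hS : ∀ k : ℕ, c - b ^ (k + 1) ∉ S) :
    Function.Injective fun k : ℕ => insert (c - b ^ (k + 1)) S := by
  intro i j hij
  have h := (Finset.insert_inj (hS i)).1 hij
  have := Int.pow_right_injective (by omega : 1 < b.natAbs) (sub_right_injective h)
  omega

lemma abs_sub_one_sub_pow_notMem {b : ℤ} (hb : b ≤ -4) (k : ℕ) :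
    |b| - 1 - b ^ (k + 1) ∉ Finset.Icc 0 (|b| - 2) := by
  have habs : |b| = -b := abs_of_neg (by omega)
  rw [habs, Finset.mem_Icc]
  rintro ⟨h₀, h₁⟩
  have hdvd : -b ∣ -b - b ^ (k + 1) := ⟨1 + b ^ k, by ring⟩
  have := Int.le_of_dvd (by omega) hdvd
  omega

lemma three_sub_pow_notMem {b : ℤ} (hb : b ≤ -4) (k : ℕ) :
    3 - b ^ (k + 1) ∉ Finset.Icc 0 |b| := by
  have habs : |b| = -b := abs_of_neg (by omega)
  rw [habs, Finset.mem_Icc]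
  rintro ⟨h₀, h₁⟩
  have hdvd : -b ∣ b ^ (k + 1) := neg_dvd.2 (dvd_pow_self b (by omega))
  have := Int.eq_zero_of_abs_lt_dvd hdvd (by rw [abs_lt]; omega)
  exact pow_ne_zero _ (by omega) this

theorem infinitely_many_digit_sets_negative_base
    (b : ℤ) (hb : b ≤ -4) :
    (∀ k : ℕ, 1 ≤ k →
      IsNumberSystem b (insert (|b| - 1 - b ^ k) (Finset.Icc 0 (|b| - 2))) ∧
      IsNumberSystem b (insert (3 - b ^ k) ((Finset.Icc 1 |b|).erase 3))) ∧
    {D : Finset ℤ | D.card = b.natAbs ∧ (0 : ℤ) ∈ D ∧ IsNumberSystem b D}.Infinite ∧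
    {D : Finset ℤ | D.card = b.natAbs ∧ (0 : ℤ) ∉ D ∧ IsNumberSystem b D}.Infinite := by
  have habs : |b| = -b := abs_of_neg (by omega)
  refine ⟨fun k hk => ⟨isNumberSystem_with_zero hb hk, isNumberSystem_without_zero hb hk⟩, ?_, ?_⟩
  · refine (Set.infinite_range_of_injective (injective_insert_sub_pow hb
      (abs_sub_one_sub_pow_notMem hb))).mono ?_
    rintro _ ⟨k, rfl⟩
    refine ⟨?_, ?_, isNumberSystem_with_zero hb (by omega)⟩
    · rw [Finset.card_insert_of_notMem (abs_sub_one_sub_pow_notMem hb k), Int.card_Icc]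
      omega
    · exact Finset.mem_insert_of_mem (Finset.mem_Icc.2 (by omega))
  · have hS (k : ℕ) : 3 - b ^ (k + 1) ∉ (Finset.Icc 1 |b|).erase 3 := fun h =>
      three_sub_pow_notMem hb k
        (Finset.Icc_subset_Icc_left zero_le_one (Finset.mem_of_mem_erase h))
    refine (Set.infinite_range_of_injective (injective_insert_sub_pow hb hS)).mono ?_
    rintro _ ⟨k, rfl⟩
    refine ⟨?_, ?_, isNumberSystem_without_zero hb (by omega)⟩
    · rw [Finset.card_insert_of_notMem (hS k),
        Finset.card_erase_of_mem (Finset.mem_Icc.2 (by omega)), Int.card_Icc]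
      omega
    · intro h
      rcases Finset.mem_insert.1 h with h | h
      · exact three_sub_pow_notMem hb k (h ▸ Finset.mem_Icc.2 ⟨le_rfl, abs_nonneg b⟩)
      · simp at h
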